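/- Universal approximation of a function and its gradient by one-layer MLPs (application of Theorem 1 of the paper with m = 1): Let φ : ℝ → ℝ be continuously differentiable, bounded and non-constant, and let f : ℝᵖ → ℝ be continuously differentiable. Then for every compact set K ⊆ ℝᵖ and every ν > 0 there exist n ∈ ℕ, coefficients c₁,…,c_n ∈ ℝ, weight vectors w₁,…,w_n ∈ ℝᵖ and biases b₁,…,b_n ∈ ℝ such that, writing f̂(x) = Σ_{i=1}^n c_i φ(⟨w_i, x⟩ + b_i) with gradient ∇f̂(x) = Σ_{i=1}^n c_i φ′(⟨w_i, x⟩ + b_i) w_i, one has sup_{x ∈ K} ( |f(x) − f̂(x)| + ‖∇f(x) − ∇f̂(x)‖ ) ≤ ν, where ‖·‖ is the Euclidean norm on ℝᵖ. -/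

import Mathlib

open scoped RealInnerProductSpace

open scoped Topology ContDiff Convolution
open MeasureTheory Filter ContinuousMap

theorem Submodule.integral_mem_of_isClosed {α X : Type*} [MeasurableSpace α] {μ : Measure α}
    [NormedAddCommGroup X] [NormedSpace ℝ X] [CompleteSpace X] {M : Submodule ℝ X}
    (hM : IsClosed (M : Set X)) {F : α → X} (hF : Integrable F μ) (hFM : ∀ u, F u ∈ M) :
    ∫ u, F u ∂μ ∈ M := by
  have : IsClosed (M : Set X) := hM
  have h := M.mkQL.integral_comp_comm hF
  have h0 : ∀ u, M.mkQL (F u) = 0 := fun u => by simpa using hFM u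
  simp only [h0, integral_zero] at h
  simpa using h.symm

namespace ContinuousMap

variable {E Y : Type*} [TopologicalSpace E] {K : Set E}
  [NormedAddCommGroup Y] [NormedSpace ℝ Y] {M : Submodule ℝ C(K, Y)} {F G : E → Y}

/-- The restriction of `F` to `K` is (continuous and) an element of `M`. -/
def RestrictMem (M : Submodule ℝ C(K, Y)) (F : E → Y) : Prop :=
  ∃ g ∈ M, ∀ x : K, g x = F x

namespace RestrictMem

theorem congr (hF : RestrictMem M F) (h : ∀ x ∈ K, F x = G x) : RestrictMem M G :=
  let ⟨g, hg, hgF⟩ := hF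
  ⟨g, hg, fun x => (hgF x).trans (h x x.2)⟩

theorem add (hF : RestrictMem M F) (hG : RestrictMem M G) :
    RestrictMem M (fun x => F x + G x) := by
  obtain ⟨f, hf, hfF⟩ := hF
  obtain ⟨g, hg, hgG⟩ := hG
  exact ⟨f + g, M.add_mem hf hg, fun x => by simp [hfF, hgG]⟩

theorem const_smul (c : ℝ) (hF : RestrictMem M F) : RestrictMem M (fun x => c • F x) := by
  obtain ⟨f, hf, hfF⟩ := hF
  exact ⟨c • f, M.smul_mem c hf, fun x => by simp [hfF]⟩

variable [CompactSpace K]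

theorem of_forall_approx (hM : IsClosed (M : Set C(K, Y))) (hF : Continuous F)
    (h : ∀ ε > 0, ∃ G, RestrictMem M G ∧ ∀ x ∈ K, dist (G x) (F x) ≤ ε) :
    RestrictMem M F := by
  let f : C(K, Y) := ⟨fun x => F x, by fun_prop⟩
  refine ⟨f, ?_, fun x => rfl⟩
  rw [← SetLike.mem_coe, ← hM.closure_eq, Metric.mem_closure_iff]
  intro ε hε
  obtain ⟨G, ⟨g, hg, hgG⟩, hGF⟩ := h (ε / 2) (half_pos hε)
  refine ⟨g, hg, ?_⟩
  rw [dist_comm]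
  refine lt_of_le_of_lt ((ContinuousMap.dist_le (half_pos hε).le).2 fun x => ?_) (half_lt_self hε)
  rw [hgG]
  exact hGF x x.2

variable [CompleteSpace Y]

theorem integral {α : Type*} [TopologicalSpace α] [MeasurableSpace α] [OpensMeasurableSpace α]
    [SecondCountableTopology α] {μ : Measure α} (hM : IsClosed (M : Set C(K, Y)))
    {F : α → E → Y} (hF : ∀ u, RestrictMem M (F u)) (hc : Continuous (Function.uncurry F))
    {bound : α → ℝ} (hb : Integrable bound μ) (hFb : ∀ u, ∀ x ∈ K, ‖F u x‖ ≤ bound u) :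
    RestrictMem M (fun x => ∫ u, F u x ∂μ) := by
  let f : α × K → Y := fun q => F q.1 q.2
  have hf : Continuous f := hc.comp (by fun_prop : Continuous fun q : α × K => (q.1, (q.2 : E)))
  let g : α → C(K, Y) := ContinuousMap.curry ⟨f, hf⟩
  have hg : Continuous g := (ContinuousMap.curry ⟨f, hf⟩).continuous
  have hgF : ∀ u (x : K), g u x = F u x := fun u x => rfl
  have hgM : ∀ u, g u ∈ M := by
    intro u
    obtain ⟨g', hg', hgF'⟩ := hF u
    convert hg'
    ext x
    rw [hgF, hgF']
  have hgi : Integrable g μ := by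
    refine (hb.norm).mono' hg.aestronglyMeasurable (Eventually.of_forall fun u => ?_)
    refine (ContinuousMap.norm_le _ (norm_nonneg _)).2 fun x => ?_
    exact (hFb u x x.2).trans (le_abs_self _)
  refine ⟨∫ u, g u ∂μ, Submodule.integral_mem_of_isClosed hM hgi hgM, fun x => ?_⟩
  rw [ContinuousMap.integral_apply hgi]
  rfl

theorem hasDerivAt (hM : IsClosed (M : Set C(K, Y))) {F F' : ℝ → E → Y}
    (hF : ∀ u, RestrictMem M (F u)) (hc : Continuous (Function.uncurry F'))
    (hd : ∀ u, ∀ x ∈ K, HasDerivAt (fun u => F u x) (F' u x) u) (u : ℝ) :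
    RestrictMem M (F' u) := by
  let f : ℝ × K → Y := fun q => F' q.1 q.2
  have hf : Continuous f := hc.comp (by fun_prop : Continuous fun q : ℝ × K => (q.1, (q.2 : E)))
  let g' : ℝ → C(K, Y) := ContinuousMap.curry ⟨f, hf⟩
  have hg' : Continuous g' := (ContinuousMap.curry ⟨f, hf⟩).continuous
  choose g hgM hg using hF
  have hint : ∀ t, ∫ s in (0 : ℝ)..t, g' s = g t - g 0 := by
    intro t
    ext x
    have h1 := (ContinuousMap.evalCLM ℝ x).intervalIntegral_comp_comm
      (hg'.intervalIntegrable (μ := volume) 0 t)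
    change _ = (ContinuousMap.evalCLM ℝ x) _ at h1
    rw [ContinuousMap.evalCLM_apply] at h1
    rw [← h1, ContinuousMap.sub_apply, hg, hg]
    refine intervalIntegral.integral_eq_sub_of_hasDerivAt (fun s _ => hd s x x.2) ?_
    exact Continuous.intervalIntegrable
      (hc.comp (by fun_prop : Continuous fun s => (s, (x : E)))) _ _
  have hder : HasDerivAt g (g' u) u := by
    have h1 := intervalIntegral.integral_hasDerivAt_right
      (hg'.intervalIntegrable (μ := volume) 0 u)
      hg'.aestronglyMeasurable.stronglyMeasurableAtFilter hg'.continuousAt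
    simp only [hint] at h1
    simpa using h1.add_const (g 0)
  refine ⟨g' u, ?_, fun x => rfl⟩
  have := hder.deriv ▸ range_deriv_subset_closure_span_image g dense_univ (Set.mem_range_self u)
  refine closure_minimal ?_ hM this
  exact Submodule.span_le.2 (by rintro _ ⟨t, -, rfl⟩; exact hgM t)

end RestrictMem

end ContinuousMap

section Polynomial
open Polynomial

theorem Polynomial.exists_derivative_eq (q : ℝ[X]) : ∃ Q : ℝ[X], Q.derivative = q := by
  induction q using Polynomial.induction_on' with
  | add p q hp hq =>
    obtain ⟨P, rfl⟩ := hp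
    obtain ⟨Q, rfl⟩ := hq
    exact ⟨P + Q, by simp⟩
  | monomial n a =>
    refine ⟨monomial (n + 1) (a / (n + 1)), ?_⟩
    rw [derivative_monomial]
    have : (n + 1 : ℝ) ≠ 0 := by positivity
    simp [this]

theorem Polynomial.exists_eval_eq_of_iteratedDeriv_eq_zero (k : ℕ) :
    ∀ {ψ : ℝ → ℝ}, ContDiff ℝ ∞ ψ → (∀ t, iteratedDeriv k ψ t = 0) →
      ∃ P : ℝ[X], ∀ t, ψ t = P.eval t := by
  induction k with
  | zero => exact fun _ h => ⟨0, fun t => by simpa using h t⟩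
  | succ k ih =>
    intro ψ hψ h
    have hψ' : ContDiff ℝ ∞ (deriv ψ) := (contDiff_infty_iff_deriv.1 hψ).2
    obtain ⟨P, hP⟩ := ih hψ' fun t => by rw [← iteratedDeriv_succ']; exact h t
    obtain ⟨Q, rfl⟩ := P.exists_derivative_eq
    have hd : Differentiable ℝ ψ := hψ.differentiable (by simp)
    have hc := is_const_of_deriv_eq_zero (f := fun t => ψ t - Q.eval t)
      (hd.sub Q.differentiable) (fun t => by
        rw [deriv_fun_sub (hd t) Q.differentiableAt, hP, Polynomial.deriv, sub_self])
    refine ⟨Q + C (ψ 0 - Q.eval 0), fun t => ?_⟩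
    have := hc t 0
    simp only [eval_add, eval_C]
    linarith

/-- A bounded smooth function that is not constant has no vanishing iterated derivative. -/
theorem exists_iteratedDeriv_ne_zero {ψ : ℝ → ℝ} (hψ : ContDiff ℝ ∞ ψ) {C : ℝ}
    (hb : ∀ t, |ψ t| ≤ C) {s t : ℝ} (hst : ψ s ≠ ψ t) (k : ℕ) :
    ∃ b, iteratedDeriv k ψ b ≠ 0 := by
  by_contra! h
  obtain ⟨P, hP⟩ := Polynomial.exists_eval_eq_of_iteratedDeriv_eq_zero k hψ h
  have hdeg : P.degree ≤ 0 := P.isBoundedUnder_abs_atTop_iff.1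
    ⟨C, eventually_map.2 (Eventually.of_forall fun t => hP t ▸ hb t)⟩
  rw [hP, hP, eq_C_of_degree_le_zero hdeg] at hst
  simp at hst

/-- On a bounded interval, a `C¹` function is approximated together with its derivative by
polynomials. -/
theorem Polynomial.exists_near_and_deriv_near {θ : ℝ → ℝ} (hθ : ContDiff ℝ 1 θ) {R ε : ℝ}
    (hR : 0 ≤ R) (hε : 0 < ε) :
    ∃ P : ℝ[X], ∀ t, |t| ≤ R →
      |P.eval t - θ t| ≤ ε ∧ |P.derivative.eval t - deriv θ t| ≤ ε := by
  have hδ : 0 < ε / (R + 1) := by positivity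
  obtain ⟨q, hq⟩ := exists_polynomial_near_of_continuousOn (-R) R (deriv θ)
    (hθ.continuous_deriv le_rfl).continuousOn _ hδ
  obtain ⟨Q, rfl⟩ := q.exists_derivative_eq
  have hle : ε / (R + 1) ≤ ε := div_le_self hε.le (by linarith)
  refine ⟨Q + C (θ 0 - Q.eval 0), fun t ht => ⟨?_, ?_⟩⟩
  · have hd : Differentiable ℝ θ := hθ.differentiable one_ne_zero
    have h := (convex_Icc (-R) R).norm_image_sub_le_of_norm_hasDerivWithin_le
      (f := fun t => Q.eval t - θ t) (f' := fun t => Q.derivative.eval t - deriv θ t)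
      (C := ε / (R + 1)) (x := 0) (y := t)
      (fun s _ => ((Q.hasDerivAt s).sub (hd s).hasDerivAt).hasDerivWithinAt)
      (fun s hs => (hq s hs).le) ⟨by linarith, hR⟩ (abs_le.1 ht)
    have h2 : ε / (R + 1) * |t - 0| ≤ ε := by
      rw [sub_zero, div_mul_eq_mul_div, div_le_iff₀ (by positivity)]
      gcongr
      linarith
    rw [Real.norm_eq_abs, Real.norm_eq_abs] at h
    simp only [eval_add, eval_C]
    rw [show Q.eval t + (θ 0 - Q.eval 0) - θ t = Q.eval t - θ t - (Q.eval 0 - θ 0) by ring]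
    exact h.trans h2
  · simpa using (hq t (abs_le.1 ht)).le.trans hle

end Polynomial

theorem integral_mul_deriv_sub_eq {φ ρ : ℝ → ℝ} (hφ : ContDiff ℝ 1 φ) (hρ : ContDiff ℝ 1 ρ)
    (hρc : HasCompactSupport ρ) (t : ℝ) :
    ∫ s, ρ s * deriv φ (t - s) = ∫ s, deriv ρ s * φ (t - s) := by
  have hφd : Differentiable ℝ φ := hφ.differentiable one_ne_zero
  have hρd : Differentiable ℝ ρ := hρ.differentiable one_ne_zero
  have hφ' := hφ.continuous_deriv le_rfl
  have hρ' := hρ.continuous_deriv le_rfl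
  have i1 : Integrable fun s => ρ s * deriv φ (t - s) :=
    Continuous.integrable_of_hasCompactSupport (by fun_prop) hρc.mul_right
  have i2 : Integrable fun s => deriv ρ s * φ (t - s) :=
    Continuous.integrable_of_hasCompactSupport (by fun_prop) hρc.deriv.mul_right
  have i3 : Integrable fun s => ρ s * φ (t - s) :=
    Continuous.integrable_of_hasCompactSupport (by fun_prop) hρc.mul_right
  have h := integral_eq_zero_of_hasDerivAt_of_integrable
    (f := fun s => ρ s * φ (t - s))
    (f' := fun s => deriv ρ s * φ (t - s) - ρ s * deriv φ (t - s))
    (fun s => by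
      have h1 : HasDerivAt (fun s => φ (t - s)) (-deriv φ (t - s)) s := by
        simpa using (hφd (t - s)).hasDerivAt.comp_const_sub t s
      exact ((hρd s).hasDerivAt.fun_mul h1).congr_deriv (by ring)) (i2.sub i1) i3
  rw [integral_sub i2 i1] at h
  linarith

theorem deriv_convolution_eq {φ ρ : ℝ → ℝ} (hφ : ContDiff ℝ 1 φ) (hρ : ContDiff ℝ 1 ρ)
    (hρc : HasCompactSupport ρ) (t : ℝ) :
    deriv (ρ ⋆ φ) t = ∫ s, ρ s * deriv φ (t - s) := by
  rw [integral_mul_deriv_sub_eq hφ hρ hρc,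
    (hρc.hasDerivAt_convolution_left _ hρ hφ.continuous.locallyIntegrable t).deriv]
  rfl

theorem integrable_mul_comp_sub {φ ρ : ℝ → ℝ} (hφ : Continuous φ) (hρ : Continuous ρ)
    (hρc : HasCompactSupport ρ) (t : ℝ) : Integrable fun s => ρ s * φ (t - s) :=
  Continuous.integrable_of_hasCompactSupport (by fun_prop) hρc.mul_right

/-- Mollifying a bounded nonconstant function keeps it bounded and nonconstant. -/
theorem exists_contDiffBump_convolution_ne {φ : ℝ → ℝ} (hφ : Continuous φ) {C : ℝ}
    (hb : ∀ t, |φ t| ≤ C) {s t : ℝ} (hst : φ s ≠ φ t) :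
    ∃ ρ : ℝ → ℝ, ContDiff ℝ ∞ ρ ∧ HasCompactSupport ρ ∧
      (∀ t, |(ρ ⋆ φ) t| ≤ 3 * C) ∧ (ρ ⋆ φ) s ≠ (ρ ⋆ φ) t := by
  let B : ℕ → ContDiffBump (0 : ℝ) := fun n =>
    ⟨1 / (n + 1) / 2, 1 / (n + 1), by positivity, half_lt_self (by positivity)⟩
  have hB : Tendsto (fun n => (B n).rOut) atTop (𝓝 0) := tendsto_one_div_add_atTop_nhds_zero_nat
  have h1 := fun x => ContDiffBump.convolution_tendsto_right_of_continuous (μ := volume) hB hφ x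
  obtain ⟨n, hn⟩ := ((((h1 s).sub (h1 t)).eventually_ne (sub_ne_zero.2 hst))).exists
  refine ⟨(B n).normed volume, (B n).contDiff_normed, (B n).hasCompactSupport_normed,
    fun x => ?_, sub_ne_zero.1 hn⟩
  have h2 := (B n).dist_normed_convolution_le (μ := volume) (x₀ := x) (g := φ) (ε := 2 * C)
    hφ.aestronglyMeasurable
    fun y _ => (abs_sub _ _).trans (by linarith [hb x, hb y])
  rw [Real.dist_eq] at h2
  linarith [abs_sub_abs_le_abs_sub (((B n).normed volume ⋆ φ) x) (φ x), hb x]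

section Ridge

variable {E : Type*} [NormedAddCommGroup E] [InnerProductSpace ℝ E]

/-- The pair of ridge functions `x ↦ (a ⟪w, x⟫, b ⟪w, x⟫ • w)`: when `b` is the derivative
of `a`, this is `x ↦ a ⟪w, x⟫` paired with its gradient. -/
noncomputable def ridge (w : E) (a b : ℝ → ℝ) (x : E) : ℝ × E :=
  (a ⟪w, x⟫, b ⟪w, x⟫ • w)

/-- All neurons with activation `φ`, paired with their gradients and restricted to `K`,
are in `M`. -/
def HasNeurons {K : Set E} (M : Submodule ℝ C(K, ℝ × E)) (φ : ℝ → ℝ) : Prop :=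
  ∀ (w : E) (b : ℝ), RestrictMem M (ridge w (fun t => φ (t + b)) (fun t => deriv φ (t + b)))

theorem exists_abs_inner_le {K : Set E} (hK : IsCompact K) (w : E) :
    ∃ R, 0 ≤ R ∧ ∀ x ∈ K, |⟪w, x⟫| ≤ R := by
  obtain ⟨R, hR⟩ := hK.exists_bound_of_continuousOn (f := fun x => ⟪w, x⟫) (by fun_prop)
  exact ⟨max R 0, le_max_right _ _, fun x hx => (hR x hx).trans (le_max_left _ _)⟩

variable {K : Set E} [CompactSpace K] {M : Submodule ℝ C(K, ℝ × E)}

theorem ContinuousMap.RestrictMem.ridge_of_contDiff (hM : IsClosed (M : Set C(K, ℝ × E)))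
    (h : ∀ (w : E) (P : Polynomial ℝ),
      RestrictMem M (ridge w (fun z => P.eval z) (fun z => P.derivative.eval z)))
    {θ : ℝ → ℝ} (hθ : ContDiff ℝ 1 θ) (w : E) : RestrictMem M (ridge w θ (deriv θ)) := by
  obtain ⟨R, hR, hKR⟩ := exists_abs_inner_le (isCompact_iff_compactSpace.2 ‹CompactSpace K›) w
  have hθ' := hθ.continuous_deriv le_rfl
  refine RestrictMem.of_forall_approx hM ?_ fun ε hε => ?_
  · have := hθ.continuous
    unfold ridge
    fun_prop
  · have hε' : 0 < ε / (‖w‖ + 1) := by positivity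
    obtain ⟨P, hP⟩ := Polynomial.exists_near_and_deriv_near hθ hR hε'
    refine ⟨_, h w P, fun x hx => ?_⟩
    obtain ⟨h1, h2⟩ := hP _ (hKR x hx)
    rw [dist_eq_norm]
    simp only [ridge, Prod.mk_sub_mk, ← sub_smul]
    refine max_le (h1.trans (div_le_self hε.le (by linarith [norm_nonneg w]))) ?_
    rw [norm_smul]
    refine (mul_le_mul_of_nonneg_right h2 (norm_nonneg w)).trans ?_
    rw [div_mul_eq_mul_div, div_le_iff₀ (by positivity)]
    gcongr
    linarith

variable [CompleteSpace E]

theorem HasNeurons.convolution (hM : IsClosed (M : Set C(K, ℝ × E))) {φ ρ : ℝ → ℝ}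
    (h : HasNeurons M φ) (hφ : ContDiff ℝ 1 φ) (hρ : ContDiff ℝ 1 ρ)
    (hρc : HasCompactSupport ρ) : HasNeurons M (ρ ⋆ φ) := by
  intro w b
  have hK : IsCompact K := isCompact_iff_compactSpace.2 ‹_›
  have hφ' := hφ.continuous_deriv le_rfl
  let F : ℝ → E → ℝ × E := fun s =>
    fun x => ρ s • ridge w (fun t => φ (t + (b - s))) (fun t => deriv φ (t + (b - s))) x
  have hF : Continuous (Function.uncurry F) := by
    have := hφ.continuous
    have := hρ.continuous
    unfold F ridge Function.uncurry
    fun_prop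
  obtain ⟨C, hC⟩ := (hρc.isCompact.prod hK).exists_bound_of_continuousOn hF.continuousOn
  have hb : Integrable ((tsupport ρ).indicator fun _ => C) :=
    (integrable_indicator_iff hρc.isCompact.measurableSet).2
      (integrableOn_const hρc.isCompact.measure_lt_top.ne)
  refine (RestrictMem.integral hM (F := F) (fun s => (h w (b - s)).const_smul _) hF hb ?_).congr ?_
  · intro s x hx
    by_cases hs : s ∈ tsupport ρ
    · simpa [hs] using hC (s, x) ⟨hs, hx⟩
    · simp [hs, F, image_eq_zero_of_notMem_tsupport hs]
  · intro x _
    have i1 := integrable_mul_comp_sub hφ.continuous hρ.continuous hρc (⟪w, x⟫ + b)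
    have i2 := integrable_mul_comp_sub hφ' hρ.continuous hρc (⟪w, x⟫ + b)
    simp only [F, ridge, Prod.smul_mk, smul_smul, smul_eq_mul, ← add_sub_assoc]
    rw [integral_pair i1 (i2.smul_const _), integral_smul_const, deriv_convolution_eq hφ hρ hρc]
    rfl

theorem HasNeurons.pow_mul_iteratedDeriv (hM : IsClosed (M : Set C(K, ℝ × E)))
    {ψ : ℝ → ℝ} (h : HasNeurons M ψ) (hψ : ContDiff ℝ ∞ ψ) (w : E) (b : ℝ) (k : ℕ) :
    ∀ u : ℝ, RestrictMem M (ridge w (fun z => z ^ k * iteratedDeriv k ψ (u * z + b))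
      (fun z => k * z ^ (k - 1) * iteratedDeriv k ψ (u * z + b)
        + u * z ^ k * iteratedDeriv (k + 1) ψ (u * z + b))) := by
  have hc : ∀ j, Continuous (iteratedDeriv j ψ) := fun j =>
    hψ.continuous_iteratedDeriv j (by exact_mod_cast le_top)
  have hd : ∀ j t, HasDerivAt (iteratedDeriv j ψ) (iteratedDeriv (j + 1) ψ t) t := fun j t => by
    rw [iteratedDeriv_succ]
    exact (hψ.differentiable_iteratedDeriv j (by exact_mod_cast WithTop.coe_lt_top j) t).hasDerivAt
  induction k with
  | zero =>
    intro u
    refine (h (u • w) b).congr fun x _ => ?_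
    simp [ridge, real_inner_smul_left, smul_smul, mul_comm]
  | succ k ih =>
    refine RestrictMem.hasDerivAt hM ih ?_ ?_
    · have := hc (k + 1)
      have := hc (k + 1 + 1)
      unfold ridge Function.uncurry
      fun_prop
    · intro u x _
      have hlin : HasDerivAt (fun u => u * ⟪w, x⟫ + b) ⟪w, x⟫ u := by
        simpa using ((hasDerivAt_id u).mul_const ⟪w, x⟫).add_const b
      have h0 := fun j => (hd j (u * ⟪w, x⟫ + b)).comp u hlin
      refine HasDerivAt.prodMk ?_ (HasDerivAt.smul_const ?_ _)
      · exact ((h0 k).const_mul _).congr_deriv (by ring)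
      · refine (((h0 k).const_mul _).add
          (((hasDerivAt_id u).mul_const _).mul (h0 (k + 1)))).congr_deriv ?_
        simp only [id, Function.comp, Nat.add_sub_cancel]
        rcases k with _ | k
        · simp
          ring
        · simp only [Nat.add_sub_cancel]
          push_cast
          ring

open Polynomial in
theorem HasNeurons.polynomial (hM : IsClosed (M : Set C(K, ℝ × E)))
    {ψ : ℝ → ℝ} (h : HasNeurons M ψ) (hψ : ContDiff ℝ ∞ ψ)
    (hne : ∀ k, ∃ b, iteratedDeriv k ψ b ≠ 0) (w : E) (P : ℝ[X]) :
    RestrictMem M (ridge w (fun z => P.eval z) (fun z => P.derivative.eval z)) := by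
  induction P using Polynomial.induction_on' with
  | add P Q hP hQ =>
    refine (hP.add hQ).congr fun x _ => ?_
    simp [ridge, add_smul]
  | monomial k a =>
    obtain ⟨b, hb⟩ := hne k
    refine ((h.pow_mul_iteratedDeriv hM hψ w b k 0).const_smul
      (a / iteratedDeriv k ψ b)).congr fun x _ => ?_
    simp only [ridge, Prod.smul_mk, smul_smul, smul_eq_mul, eval_monomial, derivative_monomial]
    congr 1
    · simp only [zero_mul, zero_add]
      field_simp
    · congr 1
      simp only [zero_mul, zero_add, add_zero]
      field_simp

end Ridge

section Gradient

variable {E : Type*} [NormedAddCommGroup E] [InnerProductSpace ℝ E] [CompleteSpace E]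

theorem hasGradientAt_integral_of_dominated {α : Type*} [MeasurableSpace α] {μ : Measure α}
    {F : α → E → ℝ} {G : α → E → E} {bound : α → ℝ} (x : E)
    (hF : ∀ x, Integrable (fun u => F u x) μ) (hG : AEStronglyMeasurable (fun u => G u x) μ)
    (hGb : ∀ u x, ‖G u x‖ ≤ bound u) (hb : Integrable bound μ)
    (h : ∀ u x, HasGradientAt (F u) (G u x) x) :
    HasGradientAt (fun x => ∫ u, F u x ∂μ) (∫ u, G u x ∂μ) x := by
  have hm : AEStronglyMeasurable (fun u => InnerProductSpace.toDual ℝ E (G u x)) μ :=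
    (InnerProductSpace.toDual ℝ E).continuous.comp_aestronglyMeasurable hG
  have key := hasFDerivAt_integral_of_dominated_of_fderiv_le (μ := μ) (𝕜 := ℝ)
    (F := fun x u => F u x) (F' := fun x u => InnerProductSpace.toDual ℝ E (G u x))
    (bound := bound) (x₀ := x) univ_mem (.of_forall fun x => (hF x).aestronglyMeasurable) (hF x) hm
    (.of_forall fun u x _ => by simpa using hGb u x) hb
    (.of_forall fun u x _ => (h u x).hasFDerivAt)
  rw [hasGradientAt_iff_hasFDerivAt]
  refine key.congr_fderiv ?_
  ext y
  have i1 : Integrable (fun u => G u x) μ := hb.mono' hG (.of_forall fun u => hGb u x)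
  have i2 : Integrable (fun u => InnerProductSpace.toDual ℝ E (G u x)) μ :=
    hb.mono' hm (.of_forall fun u => by simpa using hGb u x)
  rw [ContinuousLinearMap.integral_apply i2]
  simp only [InnerProductSpace.toDual_apply_apply]
  rw [real_inner_comm, ← integral_inner i1]
  simp only [real_inner_comm]

theorem ContDiff.continuous_gradient {f : E → ℝ} (hf : ContDiff ℝ 1 f) :
    Continuous (gradient f) :=
  (InnerProductSpace.toDual ℝ E).symm.continuous.comp (hf.continuous_fderiv one_ne_zero)

theorem HasDerivAt.hasGradientAt_comp_inner {a : ℝ → ℝ} {a' : ℝ} {w x : E}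
    (h : HasDerivAt a a' ⟪w, x⟫) : HasGradientAt (fun x => a ⟪w, x⟫) (a' • w) x := by
  rw [hasGradientAt_iff_hasFDerivAt]
  refine (h.comp_hasFDerivAt x (innerSL ℝ w).hasFDerivAt).congr_fderiv ?_
  ext y
  simp

end Gradient

section Fourier
open FourierTransform
variable {E : Type*} [NormedAddCommGroup E] [InnerProductSpace ℝ E] [FiniteDimensional ℝ E]
  [MeasurableSpace E] [BorelSpace E]
  {K : Set E} [CompactSpace K] {M : Submodule ℝ C(K, ℝ × E)}

/-- The real part of the wave `t ↦ z * exp (-2πit)`. -/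
noncomputable def realWave (z : ℂ) (t : ℝ) : ℝ :=
  z.re * Real.cos (2 * Real.pi * t) + z.im * Real.sin (2 * Real.pi * t)

theorem contDiff_realWave (z : ℂ) : ContDiff ℝ ∞ (realWave z) := by
  unfold realWave
  fun_prop

theorem abs_realWave_le (z : ℂ) (t : ℝ) : |realWave z t| ≤ 2 * ‖z‖ := by
  have h1 := z.abs_re_le_norm
  have h2 := z.abs_im_le_norm
  have h3 := Real.abs_cos_le_one (2 * Real.pi * t)
  have h4 := Real.abs_sin_le_one (2 * Real.pi * t)
  calc |realWave z t| ≤ |z.re| * |Real.cos (2 * Real.pi * t)|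
        + |z.im| * |Real.sin (2 * Real.pi * t)| := by
        rw [← abs_mul, ← abs_mul]; exact abs_add_le _ _
    _ ≤ ‖z‖ * 1 + ‖z‖ * 1 := by gcongr
    _ = 2 * ‖z‖ := by ring

theorem hasDerivAt_realWave (z : ℂ) (t : ℝ) :
    HasDerivAt (realWave z) (2 * Real.pi * realWave (-Complex.I * z) t) t := by
  have h : HasDerivAt (fun t : ℝ => 2 * Real.pi * t) (2 * Real.pi) t := by
    simpa using (hasDerivAt_id t).const_mul (2 * Real.pi)
  refine ((h.cos.const_mul z.re).add (h.sin.const_mul z.im)).congr_deriv ?_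
  simp [realWave]
  ring

theorem continuous_realWave : Continuous fun p : ℂ × ℝ => realWave p.1 p.2 := by
  unfold realWave
  fun_prop

theorem ContinuousMap.RestrictMem.gradient_of_contDiff_hasCompactSupport
    (hM : IsClosed (M : Set C(K, ℝ × E)))
    (hR : ∀ θ : ℝ → ℝ, ContDiff ℝ 1 θ → ∀ w : E, RestrictMem M (ridge w θ (deriv θ)))
    {f : E → ℝ} (hf : ContDiff ℝ ∞ f) (hfc : HasCompactSupport f) :
    RestrictMem M (fun x => (f x, gradient f x)) := by
  have hK : IsCompact K := isCompact_iff_compactSpace.2 ‹_›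
  let S : SchwartzMap E ℂ := (hfc.comp_left (g := ((↑) : ℝ → ℂ)) (by simp)).toSchwartzMap
    (Complex.ofRealCLM.contDiff.comp hf)
  let g : SchwartzMap E ℂ := 𝓕⁻ S
  have hg0 : Integrable (fun v => ‖g v‖) := g.integrable.norm
  have hg1 : Integrable (fun v => ‖v‖ * ‖g v‖) := by simpa using g.integrable_pow_mul volume 1
  have hgc := g.continuous
  have hfx : ∀ x, f x = ∫ v, realWave (g v) ⟪v, x⟫ := by
    intro x
    have h1 : 𝓕 g = S := FourierTransform.fourier_fourierInv_eq S
    have h2 : 𝓕 (g : E → ℂ) x = (f x : ℂ) := by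
      rw [← SchwartzMap.fourier_coe, h1]; rfl
    have h3 := congrArg Complex.re h2
    rw [Complex.ofReal_re, Real.fourier_eq'] at h3
    rw [← h3, ← RCLike.re_eq_complex_re, ← integral_re]
    · refine integral_congr_ae (.of_forall fun v => ?_)
      simp only [realWave, smul_eq_mul, RCLike.re_eq_complex_re, Complex.mul_re]
      rw [Complex.exp_ofReal_mul_I_re, Complex.exp_ofReal_mul_I_im, neg_mul, neg_mul, Real.cos_neg,
        Real.sin_neg]
      ring
    · refine hg0.mono' (by fun_prop) (.of_forall fun v => ?_)
      rw [norm_smul, Complex.norm_exp_ofReal_mul_I, one_mul]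
  have hint : ∀ x, Integrable fun v => realWave (g v) ⟪v, x⟫ := fun x =>
    (hg0.const_mul 2).mono' (continuous_realWave.comp (by fun_prop :
      Continuous fun v => (g v, ⟪v, x⟫))).aestronglyMeasurable
      (.of_forall fun v => abs_realWave_le _ _)
  have hder : ∀ v, deriv (realWave (g v)) =
      fun t => 2 * Real.pi * realWave (-Complex.I * g v) t := fun v =>
    funext fun t => (hasDerivAt_realWave (g v) t).deriv
  have hcont : Continuous (Function.uncurry fun v : E => fun x : E =>
      (2 * Real.pi * realWave (-Complex.I * g v) ⟪v, x⟫) • v) := by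
    have := continuous_realWave.comp (by fun_prop :
      Continuous fun q : E × E => (-Complex.I * g q.1, ⟪q.1, q.2⟫))
    exact (continuous_const.mul this).smul continuous_fst
  have hbd : ∀ v x : E, ‖(2 * Real.pi * realWave (-Complex.I * g v) ⟪v, x⟫) • v‖
      ≤ 4 * Real.pi * (‖v‖ * ‖g v‖) := by
    intro v x
    have h := abs_realWave_le (-Complex.I * g v) ⟪v, x⟫
    rw [norm_mul, norm_neg, Complex.norm_I, one_mul] at h
    rw [norm_smul, norm_mul, Real.norm_eq_abs, Real.norm_eq_abs, abs_of_pos Real.two_pi_pos]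
    calc _ ≤ 2 * Real.pi * (2 * ‖g v‖) * ‖v‖ := by gcongr
      _ = _ := by ring
  have hgrad : ∀ x, gradient f x = ∫ v, (2 * Real.pi * realWave (-Complex.I * g v) ⟪v, x⟫) • v := by
    intro x
    rw [funext hfx]
    refine (hasGradientAt_integral_of_dominated x hint ?_ hbd (hg1.const_mul _) ?_).gradient
    · exact (hcont.comp (by fun_prop : Continuous fun v : E => (v, x))).aestronglyMeasurable
    · exact fun v x => (hasDerivAt_realWave (g v) _).hasGradientAt_comp_inner
  refine (RestrictMem.integral hM (μ := volume)
    (F := fun v => ridge v (realWave (g v)) (deriv (realWave (g v))))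
    (bound := fun v => 2 * ‖g v‖ + 4 * Real.pi * (‖v‖ * ‖g v‖))
    (fun v => hR _ ((contDiff_realWave _).of_le (by simp)) v) ?_
    ((hg0.const_mul 2).add (hg1.const_mul _)) ?_).congr ?_
  · simp only [hder]
    exact (continuous_realWave.comp (by fun_prop :
      Continuous fun q : E × E => (g q.1, ⟪q.1, q.2⟫))).prodMk hcont
  · intro v x _
    simp only [hder]
    refine (norm_prod_le_iff.2 ⟨?_, ?_⟩)
    · exact (abs_realWave_le _ _).trans (le_add_of_nonneg_right (by positivity))
    · exact (hbd v x).trans (le_add_of_nonneg_left (by positivity))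
  · intro x _
    simp only [ridge, hder]
    rw [integral_pair (hint x), ← hfx, ← hgrad]
    refine (hg1.const_mul (4 * Real.pi)).mono' ?_ (.of_forall fun v => hbd v x)
    exact (hcont.comp (by fun_prop : Continuous fun v : E => (v, x))).aestronglyMeasurable

end Fourier

section SmoothApproximation

variable {E : Type*} [NormedAddCommGroup E] [InnerProductSpace ℝ E] [FiniteDimensional ℝ E]

theorem HasCompactSupport.gradient {f : E → ℝ} (hf : HasCompactSupport f) :
    HasCompactSupport (gradient f) :=
  (hf.fderiv (𝕜 := ℝ)).comp_left (g := (InnerProductSpace.toDual ℝ E).symm) (map_zero _)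

theorem IsCompact.exists_contDiff_hasCompactSupport_eventuallyEq {K : Set E} (hK : IsCompact K)
    {f : E → ℝ} (hf : ContDiff ℝ 1 f) :
    ∃ F : E → ℝ, ContDiff ℝ 1 F ∧ HasCompactSupport F ∧ ∀ x ∈ K, F =ᶠ[𝓝 x] f := by
  obtain ⟨R, hR⟩ := hK.isBounded.subset_ball_lt 0 0
  let χ : ContDiffBump (0 : E) := ⟨R, R + 1, hR.1, lt_add_one R⟩
  refine ⟨fun x => χ x * f x, χ.contDiff.mul hf, χ.hasCompactSupport.mul_right, fun x hx => ?_⟩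
  filter_upwards [χ.eventuallyEq_one_of_mem_ball (hR.2 hx)] with y hy
  simp [hy]

variable [MeasurableSpace E] [BorelSpace E]

theorem gradient_convolution_eq {ρ F : E → ℝ} (hρ : Integrable ρ) (hF : ContDiff ℝ 1 F)
    (hFc : HasCompactSupport F) (x : E) : gradient (ρ ⋆ F) x = (ρ ⋆ gradient F) x := by
  obtain ⟨C, hC⟩ := hF.continuous.bounded_above_of_compact_support hFc
  obtain ⟨D, hD⟩ := hF.continuous_gradient.bounded_above_of_compact_support hFc.gradient
  refine (hasGradientAt_integral_of_dominated (F := fun t x => ρ t • F (x - t))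
    (G := fun t x => ρ t • gradient F (x - t)) (bound := fun t => ‖ρ t‖ * D) x ?_ ?_ ?_
    (hρ.norm.mul_const D) ?_).gradient
  · intro x
    exact hρ.mul_bdd (hF.continuous.comp (by fun_prop)).aestronglyMeasurable
      (.of_forall fun t => hC (x - t))
  · exact hρ.aestronglyMeasurable.smul
      (hF.continuous_gradient.comp (by fun_prop)).aestronglyMeasurable
  · intro t x
    rw [norm_smul]
    gcongr
    exact hD _
  · intro t x
    have h := (hF.differentiable one_ne_zero (x - t)).hasGradientAt.hasFDerivAt
    rw [hasGradientAt_iff_hasFDerivAt]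
    refine (((hasFDerivAt_comp_sub t).2 h).const_smul (ρ t)).congr_fderiv ?_
    simp

variable {K : Set E} [CompactSpace K] {M : Submodule ℝ C(K, ℝ × E)}

theorem ContinuousMap.RestrictMem.gradient_of_contDiff (hM : IsClosed (M : Set C(K, ℝ × E)))
    (hS : ∀ f : E → ℝ, ContDiff ℝ ∞ f → HasCompactSupport f →
      RestrictMem M (fun x => (f x, gradient f x)))
    {f : E → ℝ} (hf : ContDiff ℝ 1 f) : RestrictMem M (fun x => (f x, gradient f x)) := by
  have hK : IsCompact K := isCompact_iff_compactSpace.2 ‹_›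
  obtain ⟨F, hF, hFc, hFf⟩ := hK.exists_contDiff_hasCompactSupport_eventuallyEq hf
  refine RestrictMem.congr (F := fun x => (F x, gradient F x)) ?_
    fun x hx => Prod.ext (hFf x hx).eq_of_nhds (hFf x hx).gradient_eq
  refine RestrictMem.of_forall_approx hM (hF.continuous.prodMk hF.continuous_gradient) ?_
  intro ε hε
  obtain ⟨δ₁, hδ₁, h₁⟩ := Metric.uniformContinuous_iff.1
    (hFc.uniformContinuous_of_continuous hF.continuous) ε hε
  obtain ⟨δ₂, hδ₂, h₂⟩ := Metric.uniformContinuous_iff.1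
    (hFc.gradient.uniformContinuous_of_continuous hF.continuous_gradient) ε hε
  have hδ := lt_min hδ₁ hδ₂
  let B : ContDiffBump (0 : E) := ⟨min δ₁ δ₂ / 2, min δ₁ δ₂, half_pos hδ, half_lt_self hδ⟩
  have hBc := B.hasCompactSupport_normed (μ := volume)
  refine ⟨_, hS (B.normed volume ⋆ F) ?_ ?_, fun x _ => ?_⟩
  · exact hBc.contDiff_convolution_left (n := ⊤) (ContinuousLinearMap.lsmul ℝ ℝ)
      B.contDiff_normed hF.continuous.locallyIntegrable
  · exact hBc.convolution (ContinuousLinearMap.lsmul ℝ ℝ) hFc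
  · rw [gradient_convolution_eq B.integrable_normed hF hFc, Prod.dist_eq]
    refine max_le ?_ ?_
    · exact B.dist_normed_convolution_le hF.continuous.aestronglyMeasurable fun y hy =>
        (h₁ (lt_of_lt_of_le hy (min_le_left _ _))).le
    · exact B.dist_normed_convolution_le hF.continuous_gradient.aestronglyMeasurable fun y hy =>
        (h₂ (lt_of_lt_of_le hy (min_le_right _ _))).le

end SmoothApproximation

section NeuronSpan

variable {E : Type*} [NormedAddCommGroup E] [InnerProductSpace ℝ E]

/-- The span of the neurons with activation `φ`, paired with their gradients and restricted
to `K`. -/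
def neuronSpan (K : Set E) (φ : ℝ → ℝ) : Submodule ℝ C(K, ℝ × E) :=
  Submodule.span ℝ {g | ∃ (w : E) (b : ℝ), ∀ x : K,
    g x = ridge w (fun t => φ (t + b)) (fun t => deriv φ (t + b)) x}

theorem exists_eq_sum_of_mem_neuronSpan {K : Set E} {φ : ℝ → ℝ} {g : C(K, ℝ × E)}
    (hg : g ∈ neuronSpan K φ) :
    ∃ (n : ℕ) (c : Fin n → ℝ) (w : Fin n → E) (b : Fin n → ℝ), ∀ x : K,
      g x = (∑ i, c i * φ (⟪w i, x⟫ + b i), ∑ i, (c i * deriv φ (⟪w i, x⟫ + b i)) • w i) := by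
  obtain ⟨n, c, u, rfl⟩ := (Submodule.mem_span_set' (R := ℝ)).1 hg
  choose w b hwb using fun i => (u i).2
  refine ⟨n, c, w, b, fun x => ?_⟩
  simp [ContinuousMap.sum_apply, hwb, ridge, Prod.ext_iff, Prod.fst_sum, Prod.snd_sum, smul_smul]

theorem hasNeurons_topologicalClosure_neuronSpan {K : Set E} [CompactSpace K] {φ : ℝ → ℝ}
    (hφ : ContDiff ℝ 1 φ) : HasNeurons (neuronSpan K φ).topologicalClosure φ := by
  intro w b
  have hc : Continuous (ridge w (fun t => φ (t + b)) (fun t => deriv φ (t + b))) := by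
    have := hφ.continuous
    have := hφ.continuous_deriv le_rfl
    unfold ridge
    fun_prop
  exact ⟨⟨_, hc.comp continuous_subtype_val⟩,
    Submodule.le_topologicalClosure _ (Submodule.subset_span ⟨w, b, fun _ => rfl⟩), fun _ => rfl⟩

end NeuronSpan

/-- universal approximation of a function and its gradient by one-layer
MLPs, case m = 1: For `φ : ℝ → ℝ` continuously differentiable, bounded and non-constant,
and `f : ℝᵖ → ℝ` continuously differentiable, for every compact `K ⊆ ℝᵖ` and `ν > 0`
there is a one-layer MLP `f̂(x) = ∑ i, c i * φ(⟪w i, x⟫ + b i)` with gradient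
`∇f̂(x) = ∑ i, c i * φ'(⟪w i, x⟫ + b i) • w i` such that
`sup_{x ∈ K} (|f x - f̂ x| + ‖∇f x - ∇f̂ x‖) ≤ ν`. -/
theorem universal_approximation_one_layer_mlp_with_gradient
    {p : ℕ} (φ : ℝ → ℝ) (hφd : ContDiff ℝ 1 φ)
    (hφb : ∃ M : ℝ, ∀ t : ℝ, |φ t| ≤ M)
    (hφnc : ¬ ∃ a : ℝ, ∀ t : ℝ, φ t = a)
    (f : EuclideanSpace ℝ (Fin p) → ℝ) (hf : ContDiff ℝ 1 f)
    (K : Set (EuclideanSpace ℝ (Fin p))) (hK : IsCompact K)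
    (ν : ℝ) (hν : 0 < ν) :
    ∃ (n : ℕ) (c : Fin n → ℝ) (w : Fin n → EuclideanSpace ℝ (Fin p)) (b : Fin n → ℝ),
      ∀ x ∈ K,
        |f x - ∑ i, c i * φ (⟪w i, x⟫ + b i)| +
          ‖gradient f x - ∑ i, (c i * deriv φ (⟪w i, x⟫ + b i)) • w i‖ ≤ ν := by
  have : CompactSpace K := isCompact_iff_compactSpace.1 hK
  obtain ⟨C, hC⟩ := hφb
  obtain ⟨s, hs⟩ : ∃ s, φ s ≠ φ 0 := by
    by_contra! h
    exact hφnc ⟨_, h⟩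
  obtain ⟨ρ, hρ, hρc, hb, hne⟩ := exists_contDiffBump_convolution_ne hφd.continuous hC hs
  have hψ : ContDiff ℝ ∞ (ρ ⋆ φ) :=
    hρc.contDiff_convolution_left _ hρ hφd.continuous.locallyIntegrable
  let M := (neuronSpan K φ).topologicalClosure
  have hM : IsClosed (M : Set C(K, ℝ × EuclideanSpace ℝ (Fin p))) :=
    Submodule.isClosed_topologicalClosure _
  have hN : HasNeurons M (ρ ⋆ φ) := (hasNeurons_topologicalClosure_neuronSpan hφd).convolution hM
    hφd (hρ.of_le (by simp)) hρc
  obtain ⟨g, hg, hgf⟩ := RestrictMem.gradient_of_contDiff hM (fun F hF hFc =>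
    RestrictMem.gradient_of_contDiff_hasCompactSupport hM (fun θ hθ w =>
      RestrictMem.ridge_of_contDiff hM (fun w P => hN.polynomial hM hψ
        (exists_iteratedDeriv_ne_zero hψ hb hne) w P) hθ w) hF hFc) hf
  obtain ⟨h, hh, hgh⟩ := Metric.mem_closure_iff.1 hg (ν / 2) (half_pos hν)
  obtain ⟨n, c, w, b, hsum⟩ := exists_eq_sum_of_mem_neuronSpan hh
  refine ⟨n, c, w, b, fun x hx => ?_⟩
  have hd := (ContinuousMap.dist_apply_le_dist (⟨x, hx⟩ : K)).trans hgh.le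
  rw [hgf, hsum, Prod.dist_eq, max_le_iff, Real.dist_eq, dist_eq_norm] at hd
  linarith [hd.1, hd.2]
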